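/- arXiv:1708.05497 — 2 statements merged into one kernel-verified Lean document; each statement's English description precedes it below -/
import Mathlib

section
/- (Cone-like curve connectivity in a Reifenberg flat domain.) Let Ω ⊂ ℝ^d (d ≥ 2) be a domain satisfying Assumption A with γ ∈ (0,1/48] and radius R0 > 0. Suppose 0 ∈ ∂Ω and R ∈ (0, R0/4], and let z0 = (R/2, 0, …, 0) in the orthonormal coordinate system associated with the origin and radius 4R for which {y : 4γR < y_1} ∩ B_{4R} ⊆ Ω ∩ B_{4R} ⊆ {y : −4γR < y_1} ∩ B_{4R}. Then for any x ∈ Ω ∩ B_R there exists a rectifiable curve η joining x and z0 such that the length ℓ(η) ≤ 5R, η ⊆ Ω ∩ B_{7R/4}, and for every point z on η: dist(z, ∂Ω) ≥ 2γ|x − z| and ℓ(η; x, z) ≤ γ^{-1}|x − z|, where ℓ(η; x, z) is the length of the portion of η from x to z. -/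
open MeasureTheory Metric Set
open scoped ENNReal RealInnerProductSpace

noncomputable section

abbrev Ed (d : ℕ) := EuclideanSpace ℝ (Fin d)

/-- Assumption A: Reifenberg flatness with parameter `γ` and radius `R0`.  A coordinate
system is encoded by the unit vector `ν` giving the direction of its first coordinate
axis. -/
def ReifenbergFlat {d : ℕ} (Ω : Set (Ed d)) (γ R0 : ℝ) : Prop :=
  ∀ x0 ∈ frontier Ω, ∀ R : ℝ, 0 < R → R ≤ R0 →
    ∃ ν : Ed d, ‖ν‖ = 1 ∧
      ({y | ⟪ν, x0⟫ + γ * R < ⟪ν, y⟫} ∩ ball x0 R ⊆ Ω ∩ ball x0 R) ∧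
      (Ω ∩ ball x0 R ⊆ {y | ⟪ν, x0⟫ - γ * R < ⟪ν, y⟫} ∩ ball x0 R)

section Helpers

variable {E : Type*} [NormedAddCommGroup E]

/-- A curve from `x` to `y` inside `G` of length at most `L`, parametrized with speed at most
one, whose initial pieces are at most `c` times longer than the corresponding chords. -/
def HasChordArcPath (G : Set E) (c : ℝ) (x y : E) (L : ℝ) : Prop :=
  ∃ (η : ℝ → E) (T : ℝ), 0 ≤ T ∧ T ≤ L ∧ η 0 = x ∧ η T = y ∧
    (∀ s t, 0 ≤ s → s ≤ t → t ≤ T → dist (η s) (η t) ≤ t - s) ∧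
    ∀ t, 0 ≤ t → t ≤ T → η t ∈ G ∧ t ≤ c * dist x (η t)

theorem HasChordArcPath.refl {G : Set E} {x : E} (hx : x ∈ G) (c : ℝ) :
    HasChordArcPath G c x x 0 := by
  refine ⟨fun _ => x, 0, le_rfl, le_rfl, rfl, rfl, ?_, ?_⟩
  · intro s t _ hst _
    simpa using hst
  · intro t _ ht
    simpa using ⟨hx, ht⟩

theorem HasChordArcPath.mono {G : Set E} {c L L' : ℝ} {x y : E}
    (h : HasChordArcPath G c x y L) (hL : L ≤ L') : HasChordArcPath G c x y L' := by
  obtain ⟨η, T, h0, hTL, h⟩ := h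
  exact ⟨η, T, h0, hTL.trans hL, h⟩

/-- Reparametrization over the unit interval, with lengths expressed by `eVariationOn`. -/
theorem HasChordArcPath.exists_eVariationOn_le {G : Set E} {c L : ℝ} {x y : E}
    (h : HasChordArcPath G c x y L) :
    ∃ η : ℝ → E, ContinuousOn η (Icc 0 1) ∧ η 0 = x ∧ η 1 = y ∧
      eVariationOn η (Icc 0 1) ≤ ENNReal.ofReal L ∧
      (∀ t ∈ Icc (0 : ℝ) 1, η t ∈ G) ∧
      ∀ t ∈ Icc (0 : ℝ) 1, eVariationOn η (Icc 0 t) ≤ ENNReal.ofReal (c * dist x (η t)) := by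
  obtain ⟨η, T, hT, hTL, hη0, hηT, hlip, hη⟩ := h
  have hmem : ∀ t ∈ Icc (0 : ℝ) 1, 0 ≤ T * t ∧ T * t ≤ T := fun t ht =>
    ⟨mul_nonneg hT ht.1, mul_le_of_le_one_right hT ht.2⟩
  have hL : LipschitzOnWith T.toNNReal (fun t => η (T * t)) (Icc 0 1) := by
    refine LipschitzOnWith.of_dist_le_mul fun s hs t ht => ?_
    rw [Real.coe_toNNReal _ hT]
    wlog hst : s ≤ t generalizing s t
    · rw [dist_comm, dist_comm s t]
      exact this t ht s hs (not_le.1 hst).le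
    refine (hlip _ _ (hmem s hs).1 (mul_le_mul_of_nonneg_left hst hT) (hmem t ht).2).trans ?_
    rw [Real.dist_eq, abs_sub_comm, abs_of_nonneg (sub_nonneg.2 hst)]
    exact (mul_sub _ _ _).ge
  have hvar : ∀ t ∈ Icc (0 : ℝ) 1,
      eVariationOn (fun t => η (T * t)) (Icc 0 t) ≤ ENNReal.ofReal (T * t) := by
    intro t ht
    have hmono : Monotone fun u : ℝ => T * u := fun u v huv => mul_le_mul_of_nonneg_left huv hT
    have hlin : eVariationOn (fun u => T * u) (Icc 0 t) ≤ ENNReal.ofReal (T * t) := by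
      simpa using ((hmono.monotoneOn (Icc 0 t)).eVariationOn_eq
        (left_mem_Icc.2 ht.1) (right_mem_Icc.2 ht.1)).le
    refine le_trans (iSup_le ?_) hlin
    rintro ⟨n, u, hu, hus⟩
    refine le_trans (Finset.sum_le_sum fun i _ => ?_) (eVariationOn.sum_le (n := n) hu hus)
    have hi : ∀ j, u j ∈ Icc (0 : ℝ) 1 := fun j => ⟨(hus j).1, (hus j).2.trans ht.2⟩
    have hle := hmono (hu i.le_succ)
    rw [edist_dist, edist_dist, dist_comm, Real.dist_eq, abs_of_nonneg (sub_nonneg.2 hle)]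
    exact ENNReal.ofReal_le_ofReal (hlip _ _ (hmem _ (hi i)).1 hle (hmem _ (hi _)).2)
  refine ⟨fun t => η (T * t), hL.continuousOn, by simpa using hη0, by simpa using hηT, ?_,
    fun t ht => (hη _ (hmem t ht).1 (hmem t ht).2).1, fun t ht => ?_⟩
  · refine (hvar 1 (right_mem_Icc.2 zero_le_one)).trans (ENNReal.ofReal_le_ofReal ?_)
    simpa using hTL
  · exact (hvar t ht).trans (ENNReal.ofReal_le_ofReal (hη _ (hmem t ht).1 (hmem t ht).2).2)

/-- Points of `Ω ∩ ball 0 r` whose distance to the boundary is at least `2 * γ` times their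
distance to `x`. -/
def coneSet (Ω : Set E) (γ r : ℝ) (x : E) : Set E :=
  {z | z ∈ Ω ∩ ball 0 r ∧ 2 * γ * dist x z ≤ infDist z (frontier Ω)}

theorem mem_coneSet_self {Ω : Set E} {γ r : ℝ} {x : E} (hx : x ∈ Ω) (hr : ‖x‖ < r) :
    x ∈ coneSet Ω γ r x :=
  ⟨⟨hx, mem_ball_zero_iff.2 hr⟩, by simpa using infDist_nonneg⟩

variable [InnerProductSpace ℝ E]

/-- A chord-arc path can be prolonged by a segment. -/
theorem HasChordArcPath.append_segment {G : Set E} {c L : ℝ} {x y y' : E}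
    (h : HasChordArcPath G c x y L)
    (hG : ∀ s ∈ Icc (0 : ℝ) 1, AffineMap.lineMap y y' s ∈ G)
    (hc : ∀ s ∈ Icc (0 : ℝ) 1, L + s * dist y y' ≤ c * dist x (AffineMap.lineMap y y' s)) :
    HasChordArcPath G c x y' (L + dist y y') := by
  obtain ⟨η, T, hT, hTL, hη0, hηT, hlip, hη⟩ := h
  rcases eq_or_ne y y' with rfl | hne
  · exact ⟨η, T, hT, by simpa using hTL, hη0, hηT, hlip, hη⟩
  set ℓ := dist y y' with hℓ
  have hℓ0 : 0 < ℓ := dist_pos.2 hne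
  set ξ : ℝ → E := fun t => AffineMap.lineMap y y' ((t - T) / ℓ) with hξ
  have hξT : ξ T = y := by simp [hξ]
  have hξd : ∀ s t, s ≤ t → dist (ξ s) (ξ t) = t - s := by
    intro s t hst
    simp only [hξ]
    rw [dist_lineMap_lineMap, Real.dist_eq, ← hℓ, abs_sub_comm,
      show (t - T) / ℓ - (s - T) / ℓ = (t - s) / ℓ by ring,
      abs_of_nonneg (div_nonneg (sub_nonneg.2 hst) hℓ0.le), div_mul_cancel₀ _ hℓ0.ne']
  refine ⟨fun t => if t ≤ T then η t else ξ t, T + ℓ, by linarith, by linarith, ?_, ?_, ?_, ?_⟩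
  · simp [hT, hη0]
  · simp [hξ, hℓ0, hℓ0.ne']
  · intro s t hs hst ht
    by_cases htT : t ≤ T
    · simpa [htT, hst.trans htT] using hlip s t hs hst htT
    · by_cases hsT : s ≤ T
      · simp only [hsT, htT, if_true, if_false]
        have h1 := hlip s T hs hsT le_rfl
        have h2 := hξd T t (not_le.1 htT).le
        rw [hηT] at h1
        rw [hξT] at h2
        linarith [dist_triangle (η s) y (ξ t)]
      · simp only [hsT, htT, if_false]
        exact (hξd s t hst).le
  · intro t ht0 ht
    by_cases htT : t ≤ T
    · simpa [htT] using hη t ht0 htT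
    · have hs : (t - T) / ℓ ∈ Icc (0 : ℝ) 1 :=
        ⟨div_nonneg (by linarith) hℓ0.le, (div_le_one hℓ0).2 (by linarith)⟩
      simp only [htT, if_false]
      refine ⟨hG _ hs, ?_⟩
      have := hc _ hs
      rw [div_mul_cancel₀ _ hℓ0.ne'] at this
      linarith

/-- In `ball x₀ ρ`, the set `Ω` is trapped between two half-spaces normal to `ν` whose boundary
hyperplanes lie at distance `δ` from `x₀`. -/
structure IsFlatFrame (Ω : Set E) (x₀ : E) (ρ δ : ℝ) (ν : E) : Prop where
  norm_eq : ‖ν‖ = 1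
  mem : ∀ y, dist y x₀ < ρ → δ < ⟪ν, y - x₀⟫ → y ∈ Ω
  lt_inner : ∀ y ∈ Ω, dist y x₀ < ρ → -δ < ⟪ν, y - x₀⟫

theorem isFlatFrame_of_subset {Ω : Set E} {x₀ ν : E} {ρ δ : ℝ} (hν : ‖ν‖ = 1)
    (h₁ : {y | ⟪ν, x₀⟫ + δ < ⟪ν, y⟫} ∩ ball x₀ ρ ⊆ Ω ∩ ball x₀ ρ)
    (h₂ : Ω ∩ ball x₀ ρ ⊆ {y | ⟪ν, x₀⟫ - δ < ⟪ν, y⟫} ∩ ball x₀ ρ) :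
    IsFlatFrame Ω x₀ ρ δ ν where
  norm_eq := hν
  mem y hy h := (h₁ ⟨by rw [inner_sub_right] at h; simp only [mem_ofPred_eq]; linarith, hy⟩).1
  lt_inner y hy h := by
    have := (h₂ ⟨hy, h⟩).1
    rw [inner_sub_right]
    simp only [mem_ofPred_eq] at this
    linarith

theorem inner_le_add_dist {ν y z : E} (x₀ : E) (hν : ‖ν‖ = 1) :
    ⟪ν, z - x₀⟫ ≤ ⟪ν, y - x₀⟫ + dist y z := by
  have h := real_inner_le_norm ν (z - y)
  rw [hν, one_mul, ← dist_eq_norm, dist_comm] at h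
  rw [← sub_add_sub_cancel z y x₀, inner_add_right]
  linarith

theorem IsFlatFrame.ball_subset {Ω : Set E} {x₀ ν z : E} {ρ δ c : ℝ}
    (h : IsFlatFrame Ω x₀ ρ δ ν) (hz : δ + c ≤ ⟪ν, z - x₀⟫) (hd : dist z x₀ + c ≤ ρ) :
    ball z c ⊆ Ω := by
  intro y hy
  rw [mem_ball] at hy
  refine h.mem y ?_ ?_
  · linarith [dist_triangle y z x₀]
  · linarith [inner_le_add_dist (y := y) (z := z) x₀ h.norm_eq]

theorem IsFlatFrame.le_infDist_frontier {Ω : Set E} {x₀ ν z : E} {ρ δ c : ℝ}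
    (h : IsFlatFrame Ω x₀ ρ δ ν) (hΩ : IsOpen Ω) (hne : (frontier Ω).Nonempty)
    (hz : δ + c ≤ ⟪ν, z - x₀⟫) (hd : dist z x₀ + c ≤ ρ) :
    c ≤ infDist z (frontier Ω) := by
  refine (le_infDist hne).2 fun p hp => ?_
  by_contra! hlt
  have hpΩ : p ∈ Ω := h.ball_subset hz hd (by rwa [mem_ball, dist_comm])
  exact (hΩ.frontier_eq ▸ hp).2 hpΩ

theorem IsFlatFrame.le_inner {Ω : Set E} {x₀ ν z : E} {ρ δ c : ℝ}
    (h : IsFlatFrame Ω x₀ ρ δ ν) (hc : 0 < c) (hball : ball z c ⊆ Ω) (hd : dist z x₀ + c ≤ ρ) :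
    c - δ ≤ ⟪ν, z - x₀⟫ := by
  by_contra! hlt
  obtain ⟨s, hs, hsc⟩ : ∃ s, max 0 (⟪ν, z - x₀⟫ + δ) < s ∧ s < c :=
    exists_between (max_lt hc (by linarith))
  have hs0 : 0 < s := (le_max_left _ _).trans_lt hs
  have hs1 : ⟪ν, z - x₀⟫ + δ < s := (le_max_right _ _).trans_lt hs
  have hdist : dist (z - s • ν) z = s := by
    simp [norm_smul, h.norm_eq, abs_of_pos hs0]
  have := h.lt_inner (z - s • ν) (hball (by rw [mem_ball, hdist]; exact hsc))
    (by linarith [dist_triangle (z - s • ν) z x₀])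
  rw [sub_right_comm, inner_sub_right, real_inner_smul_right, real_inner_self_eq_norm_sq,
    h.norm_eq] at this
  linarith

theorem inner_lineMap_sub (ν x₀ y y' : E) (s : ℝ) :
    ⟪ν, AffineMap.lineMap y y' s - x₀⟫ = (1 - s) * ⟪ν, y - x₀⟫ + s * ⟪ν, y' - x₀⟫ := by
  simp only [AffineMap.lineMap_apply_module, inner_sub_right, inner_add_right,
    real_inner_smul_right]
  ring

theorem le_inner_lineMap_sub {ν x₀ y y' : E} {s a : ℝ} (hs : s ∈ Icc (0 : ℝ) 1)
    (hy : a ≤ ⟪ν, y - x₀⟫) (hy' : a ≤ ⟪ν, y' - x₀⟫) :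
    a ≤ ⟪ν, AffineMap.lineMap y y' s - x₀⟫ := by
  rw [inner_lineMap_sub]
  nlinarith [mul_le_mul_of_nonneg_left hy (sub_nonneg.2 hs.2),
    mul_le_mul_of_nonneg_left hy' hs.1]

theorem ball_infDist_frontier_subset {Ω : Set E} {x : E} (hx : x ∈ Ω) :
    ball x (infDist x (frontier Ω)) ⊆ Ω := by
  rcases (ball x (infDist x (frontier Ω))).eq_empty_or_nonempty with he | hne
  · simp [he]
  have hpos : 0 < infDist x (frontier Ω) := nonempty_ball.1 hne
  have hdisj : ∀ q ∈ ball x (infDist x (frontier Ω)), q ∉ frontier Ω := fun q hq hqf =>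
    (infDist_le_dist_of_mem (x := x) hqf).not_gt (by rwa [mem_ball, dist_comm] at hq)
  have hcl : ∀ q ∈ ball x (infDist x (frontier Ω)), q ∈ closure Ω → q ∈ interior Ω :=
    fun q hq hqc => by_contra fun hqi => hdisj q hq ⟨hqc, hqi⟩
  by_contra hsub
  obtain ⟨p, hp, hpΩ⟩ := not_subset.1 hsub
  obtain ⟨q, -, hqi, hqc⟩ := (convex_ball x (infDist x (frontier Ω))).isPreconnected
    (interior Ω) (closure Ω)ᶜ isOpen_interior isClosed_closure.isOpen_compl
    (fun q hq => or_iff_not_imp_right.2 fun h => hcl q hq (not_not.1 h))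
    ⟨x, mem_ball_self hpos, hcl x (mem_ball_self hpos) (subset_closure hx)⟩
    ⟨p, hp, fun h => hpΩ (interior_subset (hcl p hp h))⟩
  exact hqc (interior_subset_closure hqi)

/-- Flat frames at a common centre and at scales `ρ` and `2 * ρ` have close normals. -/
theorem IsFlatFrame.le_inner_smul_of_double {Ω : Set E} {x₀ ν ν' : E} {ρ γ : ℝ}
    (h : IsFlatFrame Ω x₀ ρ (γ * ρ) ν) (h' : IsFlatFrame Ω x₀ (2 * ρ) (γ * (2 * ρ)) ν')
    (hρ : 0 < ρ) (hγ0 : 0 < γ) (hγ : γ < 1 / 2) :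
    (1 / 2 - 3 * γ) * ρ ≤ ⟪ν', (ρ / 2) • ν⟫ := by
  have hd : dist (x₀ + (ρ / 2) • ν) x₀ = ρ / 2 := by
    simp [norm_smul, h.norm_eq, abs_of_pos hρ]
  have hb : ball (x₀ + (ρ / 2) • ν) ((1 / 2 - γ) * ρ) ⊆ Ω := by
    refine h.ball_subset ?_ ?_
    · rw [add_sub_cancel_left, real_inner_smul_right, real_inner_self_eq_norm_sq, h.norm_eq]
      linarith
    · rw [hd]; nlinarith
  have := h'.le_inner (mul_pos (by linarith) hρ) hb (by rw [hd]; nlinarith)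
  rw [add_sub_cancel_left] at this
  linarith

theorem IsFlatFrame.mem_coneSet {Ω : Set E} {x₀ ν z x : E} {ρ δ c γ r : ℝ}
    (h : IsFlatFrame Ω x₀ ρ δ ν) (hΩ : IsOpen Ω) (hne : (frontier Ω).Nonempty) (hc : 0 < c)
    (hz : δ + c ≤ ⟪ν, z - x₀⟫) (hd : dist z x₀ + c ≤ ρ) (hr : ‖z‖ < r)
    (hx : 2 * γ * dist x z ≤ c) : z ∈ coneSet Ω γ r x :=
  ⟨⟨h.ball_subset hz hd (mem_ball_self hc), mem_ball_zero_iff.2 hr⟩,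
    hx.trans (h.le_infDist_frontier hΩ hne hz hd)⟩

theorem norm_lineMap_lt {y y' : E} {r s : ℝ} (hs : s ∈ Icc (0 : ℝ) 1) (hy : ‖y‖ < r)
    (hy' : ‖y'‖ < r) : ‖(AffineMap.lineMap y y' s : E)‖ < r :=
  mem_ball_zero_iff.1 ((convex_ball (0 : E) r).lineMap_mem
    (mem_ball_zero_iff.2 hy) (mem_ball_zero_iff.2 hy') hs)

theorem dist_lineMap_le {x₀ y y' : E} {r s : ℝ} (hs : s ∈ Icc (0 : ℝ) 1) (hy : dist y x₀ ≤ r)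
    (hy' : dist y' x₀ ≤ r) : dist (AffineMap.lineMap y y' s) x₀ ≤ r :=
  (convex_closedBall x₀ r).lineMap_mem (x := y) (y := y') hy hy' hs

theorem inner_sub_le_dist {ν z : E} (x₀ : E) (hν : ‖ν‖ = 1) : ⟪ν, z - x₀⟫ ≤ dist z x₀ := by
  simpa [hν, dist_eq_norm] using real_inner_le_norm ν (z - x₀)

/-- A segment is a chord-arc path. -/
theorem hasChordArcPath_segment {G : Set E} {c : ℝ} {x y : E} (hc : 1 ≤ c)
    (hG : ∀ s ∈ Icc (0 : ℝ) 1, AffineMap.lineMap x y s ∈ G) :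
    HasChordArcPath G c x y (dist x y) := by
  have hx : x ∈ G := by simpa using hG 0 (left_mem_Icc.2 zero_le_one)
  have := (HasChordArcPath.refl hx c).append_segment (y' := y) hG (fun s hs => ?_)
  · simpa using this
  · rw [dist_left_lineMap, Real.norm_of_nonneg hs.1, zero_add]
    exact le_mul_of_one_le_left (mul_nonneg hs.1 dist_nonneg) hc

/-- Points of `Ω` high above the reference hyperplane see the centre along a segment. -/
theorem hasChordArcPath_of_le_inner {Ω : Set E} {ν x : E} {R γ : ℝ}
    (h : IsFlatFrame Ω 0 (4 * R) (γ * (4 * R)) ν) (hΩ : IsOpen Ω)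
    (hne : (frontier Ω).Nonempty) (hγ0 : 0 < γ) (hγ : γ ≤ 1 / 48) (hR : 0 < R)
    (hx : x ∈ Ω) (hxR : ‖x‖ < R) (hxν : γ * (4 * R) ≤ ⟪ν, x⟫) :
    HasChordArcPath (coneSet Ω γ (7 * R / 4) x) γ⁻¹ x ((R / 2) • ν) (5 * R) := by
  have hγR : γ * R ≤ R / 48 := by nlinarith
  have hγR0 : 0 < γ * R := mul_pos hγ0 hR
  have hz0 : ‖(R / 2) • ν‖ = R / 2 := by simp [norm_smul, h.norm_eq, abs_of_pos hR]
  have hz0ν : ⟪ν, (R / 2) • ν⟫ = R / 2 := by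
    rw [real_inner_smul_right, real_inner_self_eq_norm_sq, h.norm_eq]; ring
  have hxz : dist x ((R / 2) • ν) ≤ 3 / 2 * R := by
    rw [dist_eq_norm]; linarith [norm_sub_le x ((R / 2) • ν)]
  refine HasChordArcPath.mono (hasChordArcPath_segment
    ((one_le_inv₀ hγ0).2 (by linarith)) fun s hs => ?_) (by linarith)
  rcases hs.1.eq_or_lt with rfl | hs0
  · simpa using mem_coneSet_self hx (by linarith)
  have hnorm := norm_lineMap_lt hs (show ‖x‖ < R from hxR) (by rw [hz0]; linarith)
  refine h.mem_coneSet hΩ hne (c := s * (3 * (γ * R))) (by positivity) ?_ ?_ (by linarith) ?_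
  · rw [inner_lineMap_sub, sub_zero, sub_zero, hz0ν]
    nlinarith [mul_le_mul_of_nonneg_left hxν (sub_nonneg.2 hs.2), hs.1, hs.2]
  · rw [dist_zero_right]
    nlinarith [hs.2]
  · rw [dist_left_lineMap, Real.norm_of_nonneg hs.1]
    nlinarith [mul_le_mul_of_nonneg_left hxz (mul_pos hγ0 hs0).le]

/-- The initial segment, at the scale of the distance to the boundary. -/
theorem IsFlatFrame.hasChordArcPath_initial {Ω : Set E} {x₀ ν x : E} {R γ ρ : ℝ}
    (h : IsFlatFrame Ω x₀ ρ (γ * ρ) ν) (hΩ : IsOpen Ω)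
    (hne : (frontier Ω).Nonempty) (hγ0 : 0 < γ) (hγ : γ ≤ 1 / 48)
    (hball : ball x (dist x x₀) ⊆ Ω) (hx₀ : x ≠ x₀) (hx₀R : ‖x₀‖ ≤ 7 / 6 * R)
    (hρ : 4 * dist x x₀ ≤ ρ) (hρ' : ρ ≤ 8 * dist x x₀) (hρR : ρ ≤ R) :
    HasChordArcPath (coneSet Ω γ (7 * R / 4) x) γ⁻¹ x (x₀ + (ρ / 2) • ν) (3 / 4 * ρ) := by
  have hr0 : 0 < dist x x₀ := dist_pos.2 hx₀
  set r := dist x x₀ with hr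
  have hρ0 : 0 < ρ := by linarith
  have hγρ : γ * ρ ≤ ρ / 48 := by nlinarith
  have hγr : γ * r ≤ r / 48 := by nlinarith
  have hyd : dist (x₀ + (ρ / 2) • ν) x₀ = ρ / 2 := by
    simp [norm_smul, h.norm_eq, abs_of_pos hρ0]
  have hyν : ⟪ν, x₀ + (ρ / 2) • ν - x₀⟫ = ρ / 2 := by
    rw [add_sub_cancel_left, real_inner_smul_right, real_inner_self_eq_norm_sq, h.norm_eq]; ring
  have hxν := h.le_inner hr0 hball (by linarith)
  have hxy : dist x (x₀ + (ρ / 2) • ν) ≤ r + ρ / 2 := by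
    linarith [dist_triangle_right x (x₀ + (ρ / 2) • ν) x₀]
  refine HasChordArcPath.mono (hasChordArcPath_segment
    ((one_le_inv₀ hγ0).2 (by linarith)) fun s hs => ?_) (by linarith)
  have hd := dist_lineMap_le hs (show dist x x₀ ≤ ρ / 2 by linarith) hyd.le
  have hν := le_inner_lineMap_sub (a := r - γ * ρ) hs hxν (by rw [hyν]; nlinarith)
  set z := AffineMap.lineMap x (x₀ + (ρ / 2) • ν) s with hz
  refine h.mem_coneSet hΩ hne (c := r / 2) (by positivity) (by linarith) (by linarith) ?_ ?_
  · have := norm_le_norm_add_norm_sub' z x₀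
    rw [← dist_eq_norm] at this
    linarith
  · have : dist x z ≤ r + ρ / 2 := by linarith [dist_triangle_right x z x₀]
    nlinarith

/-- Prolongation of a chord-arc path from the scale `ρ` to the scale `2 * ρ`. -/
theorem HasChordArcPath.double {Ω : Set E} {x₀ ν ν' x : E} {R γ ρ : ℝ}
    (hpath : HasChordArcPath (coneSet Ω γ (7 * R / 4) x) γ⁻¹ x (x₀ + (ρ / 2) • ν) (3 / 4 * ρ))
    (h : IsFlatFrame Ω x₀ ρ (γ * ρ) ν) (h' : IsFlatFrame Ω x₀ (2 * ρ) (γ * (2 * ρ)) ν')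
    (hΩ : IsOpen Ω) (hne : (frontier Ω).Nonempty) (hγ0 : 0 < γ) (hγ : γ ≤ 1 / 48)
    (hx₀R : ‖x₀‖ ≤ 7 / 6 * R) (hρ0 : 0 < ρ) (hρ : 4 * dist x x₀ ≤ ρ) (hρR : 2 * ρ ≤ R) :
    HasChordArcPath (coneSet Ω γ (7 * R / 4) x) γ⁻¹ x (x₀ + (2 * ρ / 2) • ν')
      (3 / 4 * (2 * ρ)) := by
  rw [mul_div_cancel_left₀ ρ two_ne_zero]
  have hγρ : γ * ρ ≤ ρ / 48 := by nlinarith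
  have hγρ0 : 0 < γ * ρ := mul_pos hγ0 hρ0
  have hyd : dist (x₀ + (ρ / 2) • ν) x₀ = ρ / 2 := by
    simp [norm_smul, h.norm_eq, abs_of_pos hρ0]
  have hyd' : dist (x₀ + ρ • ν') x₀ = ρ := by
    simp [norm_smul, h'.norm_eq, abs_of_pos hρ0]
  have hinner := h.le_inner_smul_of_double h' hρ0 hγ0 (by linarith)
  have hyν : 7 / 16 * ρ ≤ ⟪ν', x₀ + (ρ / 2) • ν - x₀⟫ := by
    rw [add_sub_cancel_left]; nlinarith
  have hyν' : ⟪ν', x₀ + ρ • ν' - x₀⟫ = ρ := by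
    rw [add_sub_cancel_left, real_inner_smul_right, real_inner_self_eq_norm_sq, h'.norm_eq]; ring
  have hyy : dist (x₀ + (ρ / 2) • ν) (x₀ + ρ • ν') ≤ 3 / 4 * ρ := by
    rw [dist_add_left, dist_eq_norm]
    refine abs_le_of_sq_le_sq' ?_ (by positivity) |>.2
    rw [norm_sub_sq_real, real_inner_smul_right, real_inner_comm, norm_smul, norm_smul,
      h.norm_eq, h'.norm_eq, mul_one, mul_one, Real.norm_of_nonneg hρ0.le,
      Real.norm_of_nonneg (by positivity : 0 ≤ ρ / 2)]
    rw [add_sub_cancel_left] at hyν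
    nlinarith
  have hz : ∀ s ∈ Icc (0 : ℝ) 1,
      dist (AffineMap.lineMap (x₀ + (ρ / 2) • ν) (x₀ + ρ • ν') s) x₀ ≤ ρ ∧
      7 / 16 * ρ ≤ ⟪ν', AffineMap.lineMap (x₀ + (ρ / 2) • ν) (x₀ + ρ • ν') s - x₀⟫ :=
    fun s hs => ⟨dist_lineMap_le hs (by linarith) hyd'.le,
      le_inner_lineMap_sub hs hyν (by linarith)⟩
  refine (hpath.append_segment (fun s hs => ?_) (fun s hs => ?_)).mono
    (L' := 3 / 4 * (2 * ρ)) (by linarith)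
  · obtain ⟨hd, hν⟩ := hz s hs
    set z := AffineMap.lineMap (x₀ + (ρ / 2) • ν) (x₀ + ρ • ν') s
    refine h'.mem_coneSet hΩ hne (c := 3 / 8 * ρ) (by positivity) (by linarith) (by linarith) ?_ ?_
    · have := norm_le_norm_add_norm_sub' z x₀
      rw [← dist_eq_norm] at this
      linarith
    · have : dist x z ≤ 2 * ρ := by linarith [dist_triangle_right x z x₀]
      nlinarith
  · obtain ⟨hd, hν⟩ := hz s hs
    set z := AffineMap.lineMap (x₀ + (ρ / 2) • ν) (x₀ + ρ • ν') s
    have h1 := inner_sub_le_dist (z := z) x₀ h'.norm_eq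
    have h2 := dist_triangle_left z x₀ x
    rw [le_inv_mul_iff₀ hγ0]
    have h3 : s * dist (x₀ + (ρ / 2) • ν) (x₀ + ρ • ν') ≤ 3 / 4 * ρ :=
      (mul_le_of_le_one_left dist_nonneg hs.2).trans hyy
    have h4 : γ * (3 / 4 * ρ + s * dist (x₀ + (ρ / 2) • ν) (x₀ + ρ • ν')) ≤
      γ * (3 / 2 * ρ) := mul_le_mul_of_nonneg_left (by linarith) hγ0.le
    linarith

/-- Prolongation of a chord-arc path from the scale `R` to the centre. -/
theorem HasChordArcPath.append_center {Ω : Set E} {x₀ ν ν' x : E} {R γ : ℝ}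
    (hpath : HasChordArcPath (coneSet Ω γ (7 * R / 4) x) γ⁻¹ x (x₀ + (R / 2) • ν') (3 / 4 * R))
    (h : IsFlatFrame Ω 0 (4 * R) (γ * (4 * R)) ν) (h' : IsFlatFrame Ω x₀ R (γ * R) ν')
    (hΩ : IsOpen Ω) (hne : (frontier Ω).Nonempty) (hγ0 : 0 < γ) (hγ : γ ≤ 1 / 48) (hR : 0 < R)
    (hxR : ‖x‖ < R) (hx₀R : ‖x₀‖ ≤ 7 / 6 * R) (hxν : ⟪ν, x⟫ ≤ γ * (4 * R)) :
    HasChordArcPath (coneSet Ω γ (7 * R / 4) x) γ⁻¹ x ((R / 2) • ν) (5 * R) := by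
  have hγR : γ * R ≤ R / 48 := by nlinarith
  have hγR0 : 0 < γ * R := mul_pos hγ0 hR
  have hz0 : ‖(R / 2) • ν‖ = R / 2 := by simp [norm_smul, h.norm_eq, abs_of_pos hR]
  have hz0ν : ⟪ν, (R / 2) • ν - 0⟫ = R / 2 := by
    rw [sub_zero, real_inner_smul_right, real_inner_self_eq_norm_sq, h.norm_eq]; ring
  have hyd : dist (x₀ + (R / 2) • ν') x₀ = R / 2 := by
    simp [norm_smul, h'.norm_eq, abs_of_pos hR]
  have hyν' : ⟪ν', x₀ + (R / 2) • ν' - x₀⟫ = R / 2 := by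
    rw [add_sub_cancel_left, real_inner_smul_right, real_inner_self_eq_norm_sq, h'.norm_eq]; ring
  set y := x₀ + (R / 2) • ν' with hy
  have hyR : ‖y‖ < 7 * R / 4 := by
    have := norm_le_norm_add_norm_sub' y x₀
    rw [← dist_eq_norm] at this
    linarith
  have hball : ball y (R / 2 - γ * R) ⊆ Ω := h'.ball_subset (by linarith) (by linarith)
  have hyν := h.le_inner (by linarith) hball (by rw [dist_zero_right]; linarith)
  have hz : ∀ s ∈ Icc (0 : ℝ) 1, ‖(AffineMap.lineMap y ((R / 2) • ν) s : E)‖ < 7 * R / 4 ∧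
      R / 2 - 5 * (γ * R) ≤ ⟪ν, AffineMap.lineMap y ((R / 2) • ν) s - 0⟫ :=
    fun s hs => ⟨norm_lineMap_lt hs hyR (by linarith),
      le_inner_lineMap_sub hs (by linarith) (by linarith)⟩
  have hyz : dist y ((R / 2) • ν) ≤ 9 / 4 * R := by
    rw [dist_eq_norm]; linarith [norm_sub_le y ((R / 2) • ν)]
  refine (hpath.append_segment (fun s hs => ?_) (fun s hs => ?_)).mono (by linarith)
  · obtain ⟨hd, hν⟩ := hz s hs
    set z := AffineMap.lineMap y ((R / 2) • ν) s
    refine h.mem_coneSet hΩ hne (c := R / 2 - 9 * (γ * R)) (by linarith) (by linarith)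
      (by rw [dist_zero_right]; linarith) hd ?_
    have : dist x z ≤ 11 / 4 * R := by rw [dist_eq_norm]; linarith [norm_sub_le x z]
    nlinarith
  · obtain ⟨hd, hν⟩ := hz s hs
    set z := AffineMap.lineMap y ((R / 2) • ν) s
    have h1 := inner_sub_le_dist (z := z) x h.norm_eq
    rw [inner_sub_right, dist_comm] at h1
    rw [sub_zero] at hν
    rw [le_inv_mul_iff₀ hγ0]
    have h3 : s * dist y ((R / 2) • ν) ≤ 9 / 4 * R :=
      (mul_le_of_le_one_left dist_nonneg hs.2).trans hyz
    have h4 : γ * (3 / 4 * R + s * dist y ((R / 2) • ν)) ≤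
      γ * (3 * R) := mul_le_mul_of_nonneg_left (by linarith) hγ0.le
    linarith

end Helpers


/-- Cone-like rectifiable curve connectivity in a Reifenberg flat domain: any point of
`Ω ∩ B_R` can be joined to the "center" `z0 = (R/2)ν` by a rectifiable curve of length at
most `5R` staying in `Ω ∩ B_{7R/4}` and quantitatively away from the boundary. -/
theorem curve_connectivity_reifenberg (d : ℕ) (hd : 2 ≤ d) (γ R0 : ℝ) (hγ0 : 0 < γ)
    (hγ : γ ≤ 1 / 48) (hR0 : 0 < R0) (Ω : Set (Ed d)) (hΩo : IsOpen Ω)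
    (hΩc : IsConnected Ω) (hreif : ReifenbergFlat Ω γ R0)
    (h0 : (0 : Ed d) ∈ frontier Ω) (R : ℝ) (hR : 0 < R) (hRle : R ≤ R0 / 4)
    (ν : Ed d) (hν : ‖ν‖ = 1)
    (hincl1 : {y | γ * (4 * R) < ⟪ν, y⟫} ∩ ball (0 : Ed d) (4 * R) ⊆ Ω ∩ ball 0 (4 * R))
    (hincl2 : Ω ∩ ball (0 : Ed d) (4 * R) ⊆ {y | -(γ * (4 * R)) < ⟪ν, y⟫} ∩ ball 0 (4 * R))
    (x : Ed d) (hx : x ∈ Ω ∩ ball (0 : Ed d) R) :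
    ∃ η : ℝ → Ed d,
      ContinuousOn η (Icc 0 1) ∧ η 0 = x ∧ η 1 = (R / 2) • ν ∧
      eVariationOn η (Icc 0 1) ≤ ENNReal.ofReal (5 * R) ∧
      (∀ t ∈ Icc (0:ℝ) 1, η t ∈ Ω ∩ ball (0 : Ed d) (7 * R / 4)) ∧
      (∀ t ∈ Icc (0:ℝ) 1, 2 * γ * dist x (η t) ≤ infDist (η t) (frontier Ω)) ∧
      (∀ t ∈ Icc (0:ℝ) 1, eVariationOn η (Icc 0 t) ≤ ENNReal.ofReal (γ⁻¹ * dist x (η t))) := by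
  have hf : IsFlatFrame Ω 0 (4 * R) (γ * (4 * R)) ν :=
    isFlatFrame_of_subset hν (by simpa using hincl1) (by simpa using hincl2)
  have hne : (frontier Ω).Nonempty := ⟨0, h0⟩
  obtain ⟨hxΩ, hxR⟩ := hx
  rw [mem_ball_zero_iff] at hxR
  suffices hpath : HasChordArcPath (coneSet Ω γ (7 * R / 4) x) γ⁻¹ x ((R / 2) • ν) (5 * R) by
    obtain ⟨η, hc, hη0, hη1, hlen, hG, hvar⟩ := hpath.exists_eVariationOn_le
    exact ⟨η, hc, hη0, hη1, hlen, fun t ht => (hG t ht).1, fun t ht => (hG t ht).2, hvar⟩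
  rcases le_total (γ * (4 * R)) ⟪ν, x⟫ with hxν | hxν
  · exact hasChordArcPath_of_le_inner hf hΩo hne hγ0 hγ hR hxΩ hxR hxν
  obtain ⟨x₀, hx₀, hr⟩ := isClosed_frontier.exists_infDist_eq_dist hne x
  have hball : ball x (dist x x₀) ⊆ Ω := hr ▸ ball_infDist_frontier_subset hxΩ
  have hxx₀ : x ≠ x₀ := by
    rintro rfl
    exact (hΩo.frontier_eq ▸ hx₀).2 hxΩ
  have hr0 : 0 < dist x x₀ := dist_pos.2 hxx₀
  have hrx : dist x x₀ ≤ ‖x‖ := by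
    rw [← hr, ← dist_zero_right]
    exact infDist_le_dist_of_mem h0
  have hrR : dist x x₀ ≤ R / 6 := by
    have := hf.le_inner hr0 hball (by rw [dist_zero_right]; linarith)
    rw [sub_zero] at this
    nlinarith
  have hx₀R : ‖x₀‖ ≤ 7 / 6 * R := by
    have := norm_le_norm_add_norm_sub' x₀ x
    rw [← dist_eq_norm, dist_comm] at this
    linarith
  have hframe : ∀ ρ, 0 < ρ → ρ ≤ R → ∃ ν', IsFlatFrame Ω x₀ ρ (γ * ρ) ν' := by
    intro ρ hρ hρR
    obtain ⟨ν', hν', h₁, h₂⟩ := hreif x₀ hx₀ ρ hρ (by linarith)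
    exact ⟨ν', isFlatFrame_of_subset hν' h₁ h₂⟩
  obtain ⟨N, hN, hN'⟩ := exists_nat_pow_near
    (show 1 ≤ R / (4 * dist x x₀) by rw [le_div_iff₀ (by positivity)]; linarith) one_lt_two
  rw [le_div_iff₀ (by positivity)] at hN
  rw [div_lt_iff₀ (by positivity), pow_succ] at hN'
  have h2N : (0 : ℝ) < 2 ^ N := by positivity
  have hρ₀ : 4 * dist x x₀ ≤ R / 2 ^ N := by rw [le_div_iff₀ h2N]; linarith
  have hρ₀' : R / 2 ^ N ≤ 8 * dist x x₀ := by rw [div_le_iff₀ h2N]; linarith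
  have hchain : ∀ k : ℕ, 2 ^ k * (R / 2 ^ N) ≤ R →
      ∃ ν', IsFlatFrame Ω x₀ (2 ^ k * (R / 2 ^ N)) (γ * (2 ^ k * (R / 2 ^ N))) ν' ∧
        HasChordArcPath (coneSet Ω γ (7 * R / 4) x) γ⁻¹ x
          (x₀ + (2 ^ k * (R / 2 ^ N) / 2) • ν') (3 / 4 * (2 ^ k * (R / 2 ^ N))) := by
    intro k
    induction k with
    | zero =>
      intro hk
      rw [pow_zero, one_mul] at hk ⊢
      obtain ⟨ν', hν'⟩ := hframe _ (by positivity) hk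
      exact ⟨ν', hν', hν'.hasChordArcPath_initial hΩo hne hγ0 hγ hball hxx₀ hx₀R hρ₀ hρ₀' hk⟩
    | succ k ih =>
      intro hk
      rw [pow_succ', mul_assoc] at hk ⊢
      have hρ : 4 * dist x x₀ ≤ 2 ^ k * (R / 2 ^ N) :=
        hρ₀.trans (le_mul_of_one_le_left (by positivity) (one_le_pow₀ one_le_two))
      obtain ⟨ν₁, hν₁, hpath⟩ := ih (by linarith)
      obtain ⟨ν', hν'⟩ := hframe _ (by positivity) hk
      exact ⟨ν', hν',
        hpath.double hν₁ hν' hΩo hne hγ0 hγ hx₀R (by positivity) hρ hk⟩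
  have hNR : 2 ^ N * (R / 2 ^ N) = R := mul_div_cancel₀ R h2N.ne'
  obtain ⟨ν', hν', hpath⟩ := hchain N hNR.le
  rw [hNR] at hν' hpath
  exact hpath.append_center hf hν' hΩo hne hγ0 hγ hR hxR hx₀R hxν
end
end

section
/- (Pointwise Riesz potential bound.) Let Ω ⊂ ℝ^d (d ≥ 2) be a domain satisfying Assumption A with γ ∈ (0,1/48] and radius R0 > 0. Suppose 0 ∈ ∂Ω and R ∈ (0, R0/4]. Set h = 4·24·48 and let z0 = (R/2, 0, …, 0) in the orthonormal coordinate system associated with the origin and radius 4R for which {y : 4γR < y_1} ∩ B_{4R} ⊆ Ω ∩ B_{4R} ⊆ {y : −4γR < y_1} ∩ B_{4R}. Let φ be a smooth function on ℝ^d with 0 ≤ φ ≤ 1, φ ≡ 1 on B_{R/(2h)}, and supp φ ⊆ B_{R/h}, and let u be a continuously differentiable real-valued function on Ω. Define ū = ‖φ‖_{L_1(ℝ^d)}^{-1} ∫_{ℝ^d} u(z)φ(z − z0) dz (the integral is over B_{R/h}(z0) ⊆ Ω). Then there is a constant N = N(d) such that for every x ∈ Ω ∩ B_R, |u(x) − ū|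 ≤ N ∫_{Ω ∩ B_{2R}} |∇u(y)| |x − y|^{1−d} dy (as an inequality in [0,∞]). -/
open MeasureTheory Metric Set
open scoped ENNReal RealInnerProductSpace

noncomputable section

/-- In the direction `n`, the set `Ω` is trapped at the point `b` and scale `ρ` between two
half spaces at distance `γ * ρ` from `b`. -/
structure FlatFrame {E : Type*} [NormedAddCommGroup E] [InnerProductSpace ℝ E]
    (Ω : Set E) (γ ρ : ℝ) (b n : E) : Prop where
  norm_eq : ‖n‖ = 1
  mem_of_lt : ∀ y ∈ ball b ρ, ⟪n, b⟫ + γ * ρ < ⟪n, y⟫ → y ∈ Ω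
  lt_of_mem : ∀ y ∈ ball b ρ, y ∈ Ω → ⟪n, b⟫ - γ * ρ < ⟪n, y⟫

namespace FlatFrame

variable {E : Type*} [NormedAddCommGroup E] [InnerProductSpace ℝ E]
  {Ω : Set E} {γ ρ : ℝ} {b n : E}

/-- Boundary points stay above the lower half space. -/
lemma le_inner_of_mem_frontier (h : FlatFrame Ω γ ρ b n) {y : E} (hy : y ∈ frontier Ω)
    (hyb : y ∈ ball b ρ) : ⟪n, b⟫ - γ * ρ ≤ ⟪n, y⟫ := by
  have hy' : y ∈ closure (Ω ∩ ball b ρ) :=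
    isOpen_ball.closure_inter ⟨frontier_subset_closure hy, hyb⟩
  have hcl : IsClosed {z : E | ⟪n, b⟫ - γ * ρ ≤ ⟪n, z⟫} :=
    isClosed_le continuous_const (by fun_prop)
  exact closure_minimal (fun z hz => (h.lt_of_mem z hz.2 hz.1).le) hcl hy'

/-- Points outside `Ω` stay below the upper half space. -/
lemma inner_le_of_notMem (h : FlatFrame Ω γ ρ b n) {y : E} (hy : y ∉ Ω)
    (hyb : y ∈ ball b ρ) : ⟪n, y⟫ ≤ ⟪n, b⟫ + γ * ρ := by
  by_contra! hlt
  exact hy (h.mem_of_lt y hyb hlt)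

/-- The directions of two frames at comparable scales and locations are close. -/
lemma le_inner_directions (h : FlatFrame Ω γ ρ b n) {b' n' : E}
    (h' : FlatFrame Ω γ (ρ / 2) b' n') (hρ : 0 < ρ) (hγ : γ ≤ 1 / 48) (hb' : b' ∉ Ω)
    (hbb : dist b' b ≤ ρ / 2) : 19 / 24 ≤ ⟪n, n'⟫ := by
  by_contra! hc
  have hup := h.inner_le_of_notMem hb' (by rw [mem_ball]; linarith)
  have hnn : ⟪n, n⟫ = 1 := by rw [real_inner_self_eq_norm_sq, h.norm_eq]; norm_num
  have hnn' : ⟪n', n'⟫ = 1 := by rw [real_inner_self_eq_norm_sq, h'.norm_eq]; norm_num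
  have hcomm : ⟪n', n⟫ = ⟪n, n'⟫ := real_inner_comm _ _
  have hγρ : γ * ρ ≤ 1 / 48 * ρ := by gcongr
  have hprod : ρ / 5 * ⟪n, n'⟫ < ρ / 5 * (19 / 24) := by gcongr
  set y : E := b' + (ρ / 5) • (n' - n) with hy
  have hyb' : dist y b' < ρ / 2 := by
    have h2 : ‖n' - n‖ ≤ 2 := by
      have := norm_sub_le n' n
      rw [h.norm_eq, h'.norm_eq] at this
      linarith
    rw [dist_eq_norm, hy, add_sub_cancel_left, norm_smul, Real.norm_of_nonneg (by positivity)]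
    nlinarith
  have hyΩ : y ∈ Ω := by
    apply h'.mem_of_lt y hyb'
    rw [hy, inner_add_right, real_inner_smul_right, inner_sub_right, hnn', hcomm]
    nlinarith
  have hlow := h.lt_of_mem y (by
    have := dist_triangle y b' b
    rw [mem_ball]; linarith) hyΩ
  rw [hy, inner_add_right, real_inner_smul_right, inner_sub_right, hnn] at hlow
  nlinarith

/-- A point deep inside `Ω` lies well above the lower half space. -/
lemma add_le_inner_of_ball_subset (h : FlatFrame Ω γ ρ b n) {x : E} {δ : ℝ}
    (hδ : 0 < δ) (hx : ball x δ ⊆ Ω) (hxb : dist x b + δ ≤ ρ) :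
    ⟪n, b⟫ - γ * ρ + δ ≤ ⟪n, x⟫ := by
  refine le_of_forall_lt_imp_le_of_dense fun a ha => ?_
  by_contra! hlt
  set s := a - (⟪n, b⟫ - γ * ρ) with hs
  rcases le_or_gt s 0 with hs0 | hs0
  · have := h.lt_of_mem x (by rw [mem_ball]; linarith) (hx (mem_ball_self hδ))
    linarith
  have hd : dist (x - s • n) x = s := by
    rw [dist_eq_norm, sub_sub_cancel_left, norm_neg, norm_smul, h.norm_eq, mul_one,
      Real.norm_of_nonneg hs0.le]
  have hsδ : s < δ := by linarith
  have := h.lt_of_mem (x - s • n) (by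
    have := dist_triangle (x - s • n) x b
    rw [mem_ball]; linarith) (hx (by rw [mem_ball, hd]; exact hsδ))
  rw [inner_sub_right, real_inner_smul_right, real_inner_self_eq_norm_sq, h.norm_eq] at this
  linarith

/-- Neighborhoods of a segment joining two points well above the upper half space are contained
in `Ω`. -/
lemma ball_subset_of_mem_segment (h : FlatFrame Ω γ ρ b n) {p q z : E} {ε : ℝ}
    (hp : ⟪n, b⟫ + γ * ρ + ε ≤ ⟪n, p⟫) (hq : ⟪n, b⟫ + γ * ρ + ε ≤ ⟪n, q⟫)
    (hpb : dist p b ≤ ρ - ε) (hqb : dist q b ≤ ρ - ε) (hz : z ∈ segment ℝ p q) :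
    ball z ε ⊆ Ω := by
  have hc1 : Convex ℝ {w : E | ⟪n, b⟫ + γ * ρ + ε ≤ ⟪n, w⟫} :=
    convex_halfSpace_ge (innerₛₗ ℝ n).isLinear _
  have hz1 : ⟪n, b⟫ + γ * ρ + ε ≤ ⟪n, z⟫ := hc1.segment_subset hp hq hz
  have hz2 : dist z b ≤ ρ - ε := (convex_closedBall b (ρ - ε)).segment_subset hpb hqb hz
  intro y hy
  rw [mem_ball] at hy
  refine h.mem_of_lt y ?_ ?_
  · have := dist_triangle y z b
    rw [mem_ball]; linarith
  · have h1 : |⟪n, y - z⟫| ≤ ‖n‖ * ‖y - z‖ := abs_real_inner_le_norm _ _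
    rw [h.norm_eq, one_mul, ← dist_eq_norm, inner_sub_right] at h1
    have := (abs_le.1 h1).1
    linarith

end FlatFrame

/-- In a Reifenberg flat domain every point can be joined to the center `(R / 2) • ν` by a chain
of points at geometrically decreasing scales, such that a neighborhood of each link, of size
comparable to its scale, is contained in the domain. -/
lemma ReifenbergFlat.exists_chain {d : ℕ} {Ω : Set (Ed d)} {γ R0 R : ℝ} {ν x : Ed d}
    (hγ : γ ≤ 1 / 48) (hΩ : IsOpen Ω) (hflat : ReifenbergFlat Ω γ R0)
    (h0 : (0 : Ed d) ∈ frontier Ω) (hR : 0 < R) (hRR : R ≤ R0 / 4)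
    (hν : FlatFrame Ω γ (4 * R) 0 ν) (hxΩ : x ∈ Ω) (hxR : ‖x‖ < R) :
    ∃ z : ℕ → Ed d, z 0 = (R / 2) • ν ∧
      (∀ k, dist (z k) x ≤ 3 / 2 * (R / 2 ^ k)) ∧
      ∀ k, ∀ p ∈ segment ℝ (z k) (z (k + 1)),
        ball p (R / 2 ^ k / (4 * 24 * 48)) ⊆ Ω ∩ ball 0 (2 * R) := by
  have h0Ω : (0 : Ed d) ∉ Ω := fun h => (hΩ.frontier_eq ▸ h0).2 h
  obtain ⟨x0, hx0, hδ⟩ := exists_mem_frontier_infDist_compl_eq_dist hxΩ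
    (fun h => h0Ω (h ▸ mem_univ _))
  have hx0Ω : x0 ∉ Ω := fun h => (hΩ.frontier_eq ▸ hx0).2 h
  set δ := dist x x0 with hδdef
  have hδpos : 0 < δ := dist_pos.2 fun h => hx0Ω (h ▸ hxΩ)
  have hδball : ball x δ ⊆ Ω := by
    rw [← hδ, ← disjoint_compl_right_iff_subset]
    exact disjoint_ball_infDist
  have hδR : δ < R := by
    have := infDist_le_dist_of_mem (x := x) (show (0 : Ed d) ∈ Ωᶜ from h0Ω)
    rw [dist_zero_right] at this
    linarith
  have hx0n : ‖x0‖ ≤ ‖x‖ + δ := by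
    have := dist_triangle x0 x 0
    rw [dist_zero_right, dist_zero_right, dist_comm x0 x] at this
    linarith
  obtain ⟨r, hr⟩ : ∃ r : ℕ → ℝ, r = fun k => R / 2 ^ k := ⟨_, rfl⟩
  have hr0 : r 0 = R := by simp [hr]
  have hrs : ∀ k, r (k + 1) = r k / 2 := fun k => by
    simp only [hr, pow_succ]; field_simp
  have hrpos : ∀ k, 0 < r k := fun k => by simp only [hr]; positivity
  have hrR : ∀ k, r k ≤ R := fun k => by
    induction k with
    | zero => exact hr0.le
    | succ k ih => rw [hrs]; linarith [hrpos k]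
  have hframe : ∀ k, ∃ p : Ed d × Ed d, FlatFrame Ω γ (4 * r k) p.1 p.2 ∧
      (k = 0 → p = (0, ν)) ∧ (k ≠ 0 → p.1 = x0) := by
    intro k
    rcases eq_or_ne k 0 with rfl | hk
    · exact ⟨(0, ν), by rw [hr0]; exact hν, fun _ => rfl, fun h => absurd rfl h⟩
    · obtain ⟨n, hn, hlow, hup⟩ := hflat x0 hx0 (4 * r k) (by linarith [hrpos k])
        (by linarith [hrR k])
      exact ⟨(x0, n), ⟨hn, fun y hy hlt => (hlow ⟨hlt, hy⟩).1, fun y hy hyΩ => (hup ⟨hyΩ, hy⟩).1⟩,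
        fun h => absurd h hk, fun _ => rfl⟩
  choose p hp hp0 hp1 using hframe
  have hx0b : ∀ k, 5 * δ < r k → dist x0 (p k).1 ≤ 4 * r k / 2 := by
    intro k hk
    rcases eq_or_ne k 0 with rfl | hk0
    · rw [hp0 0 rfl, dist_zero_right, hr0]
      rw [hr0] at hk
      linarith
    · rw [hp1 k hk0, dist_self]; linarith [hrpos k]
  have hxb : ∀ k, (k = 0 ∨ 5 * δ < 2 * r k) → dist x (p k).1 ≤ r k := by
    intro k hk
    rcases eq_or_ne k 0 with rfl | hk0
    · rw [hp0 0 rfl, dist_zero_right, hr0]; linarith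
    · rw [hp1 k hk0]
      linarith [hk.resolve_left hk0]
  obtain ⟨c, hc⟩ : ∃ c : ℕ → Ed d, c = fun k => (p k).1 + (r k / 2) • (p k).2 := ⟨_, rfl⟩
  have hcd : ∀ k, dist (c k) (p k).1 = r k / 2 := fun k => by
    rw [hc, dist_eq_norm, add_sub_cancel_left, norm_smul, (hp k).norm_eq, mul_one,
      Real.norm_of_nonneg (by linarith [hrpos k])]
  classical
  obtain ⟨z, hz⟩ : ∃ z : ℕ → Ed d, z = fun k => if k = 0 ∨ 5 * δ < 2 * r k then c k else x :=
    ⟨_, rfl⟩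
  have hzc : ∀ k, (k = 0 ∨ 5 * δ < 2 * r k) → z k = c k := fun k hk => by
    simp only [hz, if_pos hk]
  have hzx : ∀ k, ¬(k = 0 ∨ 5 * δ < 2 * r k) → z k = x := fun k hk => by
    simp only [hz, if_neg hk]
  have hzn : ∀ k, ‖z k‖ ≤ 3 / 2 * R := by
    intro k
    by_cases hk : k = 0 ∨ 5 * δ < 2 * r k
    · rw [hzc k hk]
      have h1 := dist_triangle (c k) (p k).1 0
      rw [hcd, dist_zero_right, dist_zero_right] at h1
      rcases eq_or_ne k 0 with rfl | hk0
      · rw [hp0 0 rfl, norm_zero, hr0] at h1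
        linarith
      · rw [hp1 k hk0] at h1
        obtain ⟨j, rfl⟩ := Nat.exists_eq_succ_of_ne_zero hk0
        have := hk.resolve_left hk0
        have h2 := hrs j
        have h3 := hrR j
        rw [Nat.succ_eq_add_one] at *
        linarith
    · rw [hzx k hk]; linarith
  have hγr : ∀ k, γ * (4 * r k) ≤ 1 / 48 * (4 * r k) := fun k => by
    have := hrpos k
    gcongr
  have hnn : ∀ k, ⟪(p k).2, (p k).2⟫ = 1 := fun k => by
    rw [real_inner_self_eq_norm_sq, (hp k).norm_eq]; norm_num
  refine ⟨z, ?_, ?_, ?_⟩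
  · rw [hzc 0 (Or.inl rfl), hc]
    simp [hp0 0 rfl, hr0]
  · intro k
    rw [show R / 2 ^ k = r k by rw [hr]]
    by_cases hk : k = 0 ∨ 5 * δ < 2 * r k
    · rw [hzc k hk]
      have h1 := dist_triangle_right (c k) x (p k).1
      linarith [hcd k, hxb k hk]
    · rw [hzx k hk, dist_self]; linarith [hrpos k]
  · intro k y hy
    rw [show R / 2 ^ k = r k by rw [hr]]
    have hrk := hrpos k
    refine subset_inter ?_ ?_
    · by_cases hk : k = 0 ∨ 5 * δ < 2 * r k
      · have hck1 : ⟪(p k).2, (p k).1⟫ + γ * (4 * r k) + r k / (4 * 24 * 48) ≤ ⟪(p k).2, c k⟫ := by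
          rw [hc, inner_add_right, real_inner_smul_right, hnn]
          linarith [hγr k]
        have hck2 : dist (c k) (p k).1 ≤ 4 * r k - r k / (4 * 24 * 48) := by
          rw [hcd]; linarith
        rw [hzc k hk] at hy
        by_cases hk' : 5 * δ < 2 * r (k + 1)
        · rw [hzc (k + 1) (Or.inr hk')] at hy
          have hδk : 5 * δ < r k := by rw [hrs] at hk'; linarith
          have hx0k : dist x0 (p k).1 ≤ 4 * r k / 2 := hx0b k hδk
          have hpk := hp1 (k + 1) (Nat.succ_ne_zero k)
          have hlow := (hp k).le_inner_of_mem_frontier hx0 (by rw [mem_ball]; linarith)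
          have hdir := (hp k).le_inner_directions (b' := x0) (n' := (p (k + 1)).2)
            (by
              have := hp (k + 1)
              rw [hrs, hpk] at this
              convert this using 1
              ring) (by linarith) hγ hx0Ω hx0k
          refine (hp k).ball_subset_of_mem_segment hck1 ?_ hck2 ?_ hy
          · rw [hc]
            simp only
            rw [hpk, inner_add_right, real_inner_smul_right, hrs]
            nlinarith [hγr k]
          · have h1 := hcd (k + 1)
            have h2 := dist_triangle (c (k + 1)) x0 (p k).1
            rw [hpk, hrs] at h1
            linarith
        · rw [hzx (k + 1) (by simpa using hk')] at hy
          have hδk : r k ≤ 5 * δ := by rw [hrs] at hk'; linarith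
          have hxk := hxb k hk
          have hδr : δ ≤ r k := by
            rcases hk with rfl | hk
            · rw [hr0]; exact hδR.le
            · linarith
          refine (hp k).ball_subset_of_mem_segment hck1 ?_ hck2 (by linarith) hy
          have := (hp k).add_le_inner_of_ball_subset hδpos hδball (by linarith)
          linarith [hγr k]
      · have hk' : ¬(k + 1 = 0 ∨ 5 * δ < 2 * r (k + 1)) := by
          rw [hrs]
          push Not at hk ⊢
          exact ⟨Nat.succ_ne_zero k, by linarith [hk.2]⟩
        rw [hzx k hk, hzx (k + 1) hk', segment_same, mem_singleton_iff] at hy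
        push Not at hk
        rw [hy]
        exact (ball_subset_ball (by linarith [hk.2])).trans hδball
    · have hyn : y ∈ closedBall (0 : Ed d) (3 / 2 * R) :=
        (convex_closedBall (0 : Ed d) (3 / 2 * R)).segment_subset
          (mem_closedBall_zero_iff.2 (hzn k)) (mem_closedBall_zero_iff.2 (hzn (k + 1))) hy
      refine ball_subset_ball' ?_
      rw [mem_closedBall] at hyn
      linarith [hrR k]

section Averages

variable {E : Type*} [NormedAddCommGroup E] [NormedSpace ℝ E]

/-- The increment of a function along a segment is bounded by the integral of its derivative. -/
lemma enorm_sub_le_lintegral_lineMap {Ω : Set E} {u : E → ℝ} {u' : E → E →L[ℝ] ℝ}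
    (hu : ∀ y ∈ Ω, HasFDerivAt u (u' y) y) (hu' : ContinuousOn u' Ω) {a b : E}
    (hab : ∀ t ∈ Icc (0 : ℝ) 1, AffineMap.lineMap a b t ∈ Ω) :
    ‖u a - u b‖ₑ ≤ ∫⁻ t in Icc (0 : ℝ) 1, ‖u' (AffineMap.lineMap a b t)‖ₑ * edist a b := by
  have hcont : ContinuousOn (fun t : ℝ => u' (AffineMap.lineMap a b t) (b - a)) (Icc 0 1) :=
    (hu'.comp (by fun_prop) hab).clm_apply continuousOn_const
  have hftc : ∫ t in (0 : ℝ)..1, u' (AffineMap.lineMap a b t) (b - a) = u b - u a := by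
    have := intervalIntegral.integral_eq_sub_of_hasDerivAt
      (f := fun t : ℝ => u (AffineMap.lineMap a b t))
      (f' := fun t : ℝ => u' (AffineMap.lineMap a b t) (b - a)) (a := 0) (b := 1)
      (fun t ht => by
        rw [uIcc_of_le zero_le_one] at ht
        exact (hu _ (hab t ht)).comp_hasDerivAt t AffineMap.hasDerivAt_lineMap)
      (ContinuousOn.intervalIntegrable (by rwa [uIcc_of_le zero_le_one]))
    simpa using this
  rw [← enorm_neg, neg_sub, ← hftc, intervalIntegral.integral_of_le zero_le_one,
    ← integral_Icc_eq_integral_Ioc]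
  refine (enorm_integral_le_lintegral_enorm _).trans (lintegral_mono fun t => ?_)
  rw [edist_comm, edist_eq_enorm_sub]
  exact ContinuousLinearMap.le_opENorm _ _

lemma continuous_comp_add_smul_mul {Ω : Set E} {u φ : E → ℝ} (hΩ : IsOpen Ω)
    (hu : ContinuousOn u Ω) (hφ : Continuous φ) {a : E} {s : ℝ}
    (h : ∀ w ∈ tsupport φ, a + s • w ∈ Ω) : Continuous fun w => u (a + s • w) * φ w := by
  refine continuous_of_tsupport fun w hw => ?_
  have hw' : a + s • w ∈ Ω := h w (tsupport_mul_subset_right hw)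
  have h1 : ContinuousAt u (a + s • w) := hu.continuousAt (hΩ.mem_nhds hw')
  have h2 : ContinuousAt (fun w : E => a + s • w) w := by fun_prop
  exact (ContinuousAt.comp (f := fun w : E => a + s • w) h1 h2).mul hφ.continuousAt

variable [FiniteDimensional ℝ E] [MeasurableSpace E] [BorelSpace E] {μ : Measure E}
  [μ.IsAddHaarMeasure]

lemma lintegral_comp_add_smul {f : E → ℝ≥0∞} (hf : Measurable f) (a : E) {s : ℝ} (hs : 0 < s) :
    ∫⁻ w, f (a + s • w) ∂μ = ENNReal.ofReal ((s ^ Module.finrank ℝ E)⁻¹) * ∫⁻ y, f y ∂μ := by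
  have h1 : ∫⁻ w, f (a + s • w) ∂μ = ∫⁻ y, f (a + y) ∂(μ.map (s • ·)) :=
    (lintegral_map (hf.comp (measurable_const_add a)) (measurable_const_smul s)).symm
  rw [h1, Measure.map_addHaar_smul μ hs.ne', lintegral_smul_measure, lintegral_add_left_eq_self,
    abs_of_pos (by positivity), smul_eq_mul]

/-- Weighted averages of a function at two locations and scales differ at most by the integral
of its derivative over any region containing the straight paths between them. -/
lemma enorm_integral_sub_integral_le {Ω : Set E} {u φ : E → ℝ} {u' : E → E →L[ℝ] ℝ}
    (hΩ : IsOpen Ω) (hu : ∀ y ∈ Ω, HasFDerivAt u (u' y) y) (hu' : ContinuousOn u' Ω)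
    (hφ : Continuous φ) (hφc : HasCompactSupport φ) (hφ1 : ∀ w, ‖φ w‖ ≤ 1)
    {f : E → ℝ≥0∞} (hf : Measurable f) {a b : E} {s s' L : ℝ} (hs' : 0 < s') (hss : s' ≤ s)
    (hpath : ∀ w ∈ tsupport φ, ∀ t ∈ Icc (0 : ℝ) 1,
      AffineMap.lineMap a b t + (AffineMap.lineMap s s' t : ℝ) • w ∈ Ω)
    (hfu : ∀ w ∈ tsupport φ, ∀ t ∈ Icc (0 : ℝ) 1,
      ‖u' (AffineMap.lineMap a b t + (AffineMap.lineMap s s' t : ℝ) • w)‖ₑ ≤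
        f (AffineMap.lineMap a b t + (AffineMap.lineMap s s' t : ℝ) • w))
    (hL : ∀ w ∈ tsupport φ, dist (a + s • w) (b + s' • w) ≤ L) :
    ‖∫ w, u (a + s • w) * φ w ∂μ - ∫ w, u (b + s' • w) * φ w ∂μ‖ₑ ≤
      ENNReal.ofReal (L * (s' ^ Module.finrank ℝ E)⁻¹) * ∫⁻ y, f y ∂μ := by
  have huc : ContinuousOn u Ω := fun y hy => (hu y hy).continuousAt.continuousWithinAt
  have hia : Integrable (fun w => u (a + s • w) * φ w) μ :=
    (continuous_comp_add_smul_mul hΩ huc hφ fun w hw => by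
      simpa using hpath w hw 0 (by simp)).integrable_of_hasCompactSupport hφc.mul_left
  have hib : Integrable (fun w => u (b + s' • w) * φ w) μ :=
    (continuous_comp_add_smul_mul hΩ huc hφ fun w hw => by
      simpa using hpath w hw 1 (by simp)).integrable_of_hasCompactSupport hφc.mul_left
  have hline : ∀ (w : E) (t : ℝ), AffineMap.lineMap (a + s • w) (b + s' • w) t =
      AffineMap.lineMap a b t + (AffineMap.lineMap s s' t : ℝ) • w := fun w t => by
    simp only [AffineMap.lineMap_apply_module, smul_eq_mul]
    module
  have hpt : ∀ w, ‖u (a + s • w) * φ w - u (b + s' • w) * φ w‖ₑ ≤ ∫⁻ t in Icc (0 : ℝ) 1,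
      f (AffineMap.lineMap a b t + (AffineMap.lineMap s s' t : ℝ) • w) * ENNReal.ofReal L := by
    intro w
    by_cases hw : w ∈ tsupport φ
    · rw [← sub_mul, enorm_mul]
      have h1 : ‖φ w‖ₑ ≤ 1 := by
        rw [← ofReal_norm]; exact ENNReal.ofReal_le_one.2 (hφ1 w)
      refine (mul_le_of_le_one_right' h1).trans
        ((enorm_sub_le_lintegral_lineMap hu hu' fun t ht => ?_).trans
          (setLIntegral_mono' measurableSet_Icc fun t ht => ?_))
      · rw [hline]; exact hpath w hw t ht
      · rw [hline, edist_dist]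
        gcongr
        · exact hfu w hw t ht
        · exact hL w hw
    · simp [image_eq_zero_of_notMem_tsupport hw]
  have hmeas : Measurable fun q : E × ℝ =>
      f (AffineMap.lineMap a b q.2 + (AffineMap.lineMap s s' q.2 : ℝ) • q.1) *
        ENNReal.ofReal L := by
    refine (hf.comp (Continuous.measurable ?_)).mul_const _
    simp only [AffineMap.lineMap_apply_module]
    fun_prop
  rw [← integral_sub hia hib]
  calc _ ≤ ∫⁻ w, ‖u (a + s • w) * φ w - u (b + s' • w) * φ w‖ₑ ∂μ :=
        enorm_integral_le_lintegral_enorm _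
    _ ≤ ∫⁻ w, (∫⁻ t in Icc (0 : ℝ) 1,
          f (AffineMap.lineMap a b t + (AffineMap.lineMap s s' t : ℝ) • w) *
            ENNReal.ofReal L) ∂μ :=
        lintegral_mono hpt
    _ = ∫⁻ t in Icc (0 : ℝ) 1, (∫⁻ w,
          f (AffineMap.lineMap a b t + (AffineMap.lineMap s s' t : ℝ) • w) *
            ENNReal.ofReal L ∂μ) := lintegral_lintegral_swap hmeas.aemeasurable
    _ ≤ ∫⁻ t in Icc (0 : ℝ) 1,
          ENNReal.ofReal (L * (s' ^ Module.finrank ℝ E)⁻¹) * ∫⁻ y, f y ∂μ := by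
        refine setLIntegral_mono' measurableSet_Icc fun t ht => ?_
        have hst : s' ≤ AffineMap.lineMap s s' t := by
          rw [AffineMap.lineMap_apply_module, smul_eq_mul, smul_eq_mul]
          nlinarith [ht.1, ht.2]
        rw [lintegral_mul_const' _ _ ENNReal.ofReal_ne_top,
          lintegral_comp_add_smul hf _ (hs'.trans_le hst), mul_comm L,
          ENNReal.ofReal_mul (by positivity), mul_right_comm]
        gcongr
    _ = _ := by simp

end Averages

/-- A weighted average of values within `ε` of `c` is within `ε` of `c`. -/
lemma abs_sub_inv_integral_mul_le {E : Type*} [TopologicalSpace E] [MeasurableSpace E]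
    {μ : Measure E} {v φ : E → ℝ} (hv : Integrable (fun w => v w * φ w) μ)
    (hφ : Integrable φ μ) (hφ0 : ∀ w, 0 ≤ φ w) (hpos : 0 < ∫ w, φ w ∂μ) {c ε : ℝ}
    (hc : ∀ w ∈ tsupport φ, |c - v w| ≤ ε) :
    |c - (∫ w, φ w ∂μ)⁻¹ * ∫ w, v w * φ w ∂μ| ≤ ε := by
  have h1 : c - (∫ w, φ w ∂μ)⁻¹ * ∫ w, v w * φ w ∂μ =
      (∫ w, φ w ∂μ)⁻¹ * ∫ w, (c - v w) * φ w ∂μ := by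
    simp only [sub_mul]
    rw [integral_sub (hφ.const_mul c) hv, integral_const_mul, mul_sub, mul_comm c,
      inv_mul_cancel_left₀ hpos.ne']
  have h2 : |∫ w, (c - v w) * φ w ∂μ| ≤ ∫ w, ε * φ w ∂μ := by
    rw [← Real.norm_eq_abs]
    refine norm_integral_le_of_norm_le (hφ.const_mul ε) (Filter.Eventually.of_forall fun w => ?_)
    rw [norm_mul, Real.norm_of_nonneg (hφ0 w)]
    by_cases hw : w ∈ tsupport φ
    · exact mul_le_mul_of_nonneg_right (hc w hw) (hφ0 w)
    · simp [image_eq_zero_of_notMem_tsupport hw]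
  rw [h1, abs_mul, abs_of_pos (inv_pos.2 hpos), inv_mul_le_iff₀ hpos]
  rwa [integral_const_mul, mul_comm ε] at h2

/-- Geometric sum over the dyadic scales that exceed half of a given distance. -/
lemma sum_dyadic_inv_pow_le {R D : ℝ} (hR : 0 < R) (hD : 0 < D) (m n : ℕ) :
    ∑ k ∈ Finset.range n, (if D < 2 * (R / 2 ^ k) then ((R / 2 ^ k) ^ (m + 1))⁻¹ else 0) ≤
      2 * (2 / D) ^ (m + 1) := by
  have hterm : ∀ k, (if D < 2 * (R / 2 ^ k) then ((R / 2 ^ k) ^ (m + 1))⁻¹ else 0) ≤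
      (2 / D) ^ m / R * (if (2 : ℝ) ^ k < 2 * R / D then 2 ^ k else 0) := by
    intro k
    have hiff : D < 2 * (R / 2 ^ k) ↔ (2 : ℝ) ^ k < 2 * R / D := by
      rw [lt_div_iff₀ hD, ← mul_div_assoc, lt_div_iff₀ (by positivity), mul_comm]
    by_cases h : D < 2 * (R / 2 ^ k)
    · rw [if_pos h, if_pos (hiff.1 h)]
      have h1 : (R / 2 ^ k)⁻¹ ≤ 2 / D := by
        rw [inv_le_comm₀ (by positivity) (by positivity), inv_div]
        linarith
      calc ((R / 2 ^ k) ^ (m + 1))⁻¹ = ((R / 2 ^ k)⁻¹) ^ m * (2 ^ k / R) := by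
            rw [← inv_pow, pow_succ, inv_div]
        _ ≤ (2 / D) ^ m * (2 ^ k / R) := by gcongr
        _ = _ := by ring
    · rw [if_neg h, if_neg (fun h' => h (hiff.2 h')), mul_zero]
  have hgeom : ∀ n, ∑ k ∈ Finset.range n, (if (2 : ℝ) ^ k < 2 * R / D then (2 : ℝ) ^ k else 0) ≤
      min (2 ^ n) (2 * (2 * R / D)) := by
    intro n
    induction n with
    | zero => simp; positivity
    | succ n ih =>
      rw [Finset.sum_range_succ]
      have h1 := ih.trans (min_le_left _ _)
      have h2 := ih.trans (min_le_right _ _)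
      have h3 : (0 : ℝ) < 2 ^ n := by positivity
      split_ifs with h
      · exact le_min (by rw [pow_succ]; linarith) (by linarith)
      · exact le_min (by rw [pow_succ]; linarith) (by linarith)
  calc _ ≤ ∑ k ∈ Finset.range n,
        (2 / D) ^ m / R * (if (2 : ℝ) ^ k < 2 * R / D then 2 ^ k else 0) :=
        Finset.sum_le_sum fun k _ => hterm k
    _ ≤ (2 / D) ^ m / R * (2 * (2 * R / D)) := by
        rw [← Finset.mul_sum]
        gcongr
        exact (hgeom n).trans (min_le_right _ _)
    _ = _ := by rw [pow_succ]; field_simp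

/-- The kernels of averages at dyadic scales add up to at most a multiple of the Riesz kernel. -/
lemma sum_dyadic_kernel_le {d : ℕ} (hd : 2 ≤ d) {C R : ℝ} (hC : 0 ≤ C) (hR : 0 < R) (n : ℕ)
    (x y : Ed d) :
    ∑ k ∈ Finset.range n,
        (ball x (2 * (R / 2 ^ k))).indicator
          (fun _ => ENNReal.ofReal (C * ((R / 2 ^ k) ^ (d - 1))⁻¹)) y ≤
      ENNReal.ofReal (C * 2 ^ d + 1) * edist x y ^ ((1 : ℝ) - d) := by
  obtain ⟨m, rfl⟩ := Nat.exists_eq_add_of_le' hd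
  have hexp : (1 : ℝ) - ((m + 2 : ℕ) : ℝ) = -((m + 1 : ℕ) : ℝ) := by push_cast; ring
  rw [hexp, ENNReal.rpow_neg, ENNReal.rpow_natCast]
  rcases eq_or_ne x y with rfl | hxy
  · rw [edist_self, zero_pow (by omega), ENNReal.inv_zero, ENNReal.mul_top]
    · exact le_top
    · rw [Ne, ENNReal.ofReal_eq_zero, not_le]; positivity
  have hD : 0 < dist x y := dist_pos.2 hxy
  have hterm : ∀ k, (ball x (2 * (R / 2 ^ k))).indicator
      (fun _ => ENNReal.ofReal (C * ((R / 2 ^ k) ^ (m + 2 - 1))⁻¹)) y = ENNReal.ofReal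
      (C * (if dist x y < 2 * (R / 2 ^ k) then ((R / 2 ^ k) ^ (m + 1))⁻¹ else 0)) := by
    intro k
    classical
    simp only [indicator_apply, mem_ball, dist_comm y x]
    split_ifs <;> simp
  rw [Finset.sum_congr rfl fun k _ => hterm k, ← ENNReal.ofReal_sum_of_nonneg
    (fun k _ => by positivity), edist_dist, ← ENNReal.ofReal_pow hD.le,
    ← ENNReal.ofReal_inv_of_pos (by positivity), ← ENNReal.ofReal_mul (by positivity),
    ← Finset.mul_sum]
  refine ENNReal.ofReal_le_ofReal ?_
  calc _ ≤ C * (2 * (2 / dist x y) ^ (m + 1)) := by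
        gcongr
        exact sum_dyadic_inv_pow_le hR hD m n
    _ = C * 2 ^ (m + 2) * (dist x y ^ (m + 1))⁻¹ := by rw [div_pow]; ring
    _ ≤ _ := by gcongr; linarith

/-- The integral of a nonnegative compactly supported function dominates the volume of a ball on
which it equals one. -/
lemma pow_mul_volume_ball_le_integral {d : ℕ} {φ : Ed d → ℝ} {ρ : ℝ} (hρ : 0 < ρ)
    (hφ : Integrable φ) (hφ0 : ∀ w, 0 ≤ φ w) (hφ1 : ∀ w ∈ ball (0 : Ed d) ρ, φ w = 1) :
    ρ ^ d * volume.real (ball (0 : Ed d) 1) ≤ ∫ w, φ w := by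
  have h1 : volume.real (ball (0 : Ed d) ρ) = ρ ^ d * volume.real (ball (0 : Ed d) 1) := by
    rw [Measure.real, Measure.addHaar_ball_of_pos _ _ hρ, ENNReal.toReal_mul,
      ENNReal.toReal_ofReal (by positivity), finrank_euclideanSpace_fin, Measure.real]
  rw [← h1]
  calc volume.real (ball (0 : Ed d) ρ) = ∫ w in ball (0 : Ed d) ρ, φ w := by
        rw [setIntegral_congr_fun measurableSet_ball hφ1]; simp
    _ ≤ _ := setIntegral_le_integral hφ (Filter.Eventually.of_forall hφ0)

/-- Pointwise Riesz potential bound in a Reifenberg flat domain: the deviation of `u` from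
a smoothed average near the "center" `z0 = (R/2)ν` is controlled by the Riesz potential of
`|∇u|`.  Here `h = 4·24·48`. -/
theorem riesz_potential_bound_reifenberg (d : ℕ) (hd : 2 ≤ d) :
    ∃ N : ℝ, 0 < N ∧
      ∀ (γ R0 : ℝ), 0 < γ → γ ≤ 1 / 48 → 0 < R0 →
      ∀ Ω : Set (Ed d), IsOpen Ω → IsConnected Ω → ReifenbergFlat Ω γ R0 →
        (0 : Ed d) ∈ frontier Ω →
      ∀ R : ℝ, 0 < R → R ≤ R0 / 4 →
      ∀ ν : Ed d, ‖ν‖ = 1 →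
        ({y | γ * (4 * R) < ⟪ν, y⟫} ∩ ball (0 : Ed d) (4 * R) ⊆ Ω ∩ ball 0 (4 * R)) →
        (Ω ∩ ball (0 : Ed d) (4 * R) ⊆
          {y | -(γ * (4 * R)) < ⟪ν, y⟫} ∩ ball 0 (4 * R)) →
      ∀ φ : Ed d → ℝ, ContDiff ℝ (⊤ : ℕ∞) φ → (∀ z, 0 ≤ φ z) → (∀ z, φ z ≤ 1) →
        (∀ z ∈ ball (0 : Ed d) (R / (2 * (4 * 24 * 48))), φ z = 1) →
        tsupport φ ⊆ ball (0 : Ed d) (R / (4 * 24 * 48)) →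
      ∀ (u : Ed d → ℝ) (u' : Ed d → (Ed d →L[ℝ] ℝ)),
        (∀ y ∈ Ω, HasFDerivAt u (u' y) y) → ContinuousOn u' Ω →
      ∀ x ∈ Ω ∩ ball (0 : Ed d) R,
        ENNReal.ofReal
            |u x - (∫ z, |φ z|)⁻¹ *
              ∫ z in ball ((R / 2) • ν) (R / (4 * 24 * 48)), u z * φ (z - (R / 2) • ν)| ≤
          ENNReal.ofReal N *
            ∫⁻ y in Ω ∩ ball (0 : Ed d) (2 * R),
              ENNReal.ofReal ‖u' y‖ * (edist x y) ^ ((1 : ℝ) - d) := by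
  set V := volume.real (ball (0 : Ed d) 1) with hVdef
  have hV : 0 < V :=
    ENNReal.toReal_pos (measure_ball_pos _ _ one_pos).ne' measure_ball_lt_top.ne
  set C : ℝ := 3 * 2 ^ d * (2 * (4 * 24 * 48)) ^ d / V with hC
  have hCpos : 0 < C := by positivity
  refine ⟨C * 2 ^ d + 1, by positivity, ?_⟩
  intro γ R0 _ hγ _ Ω hΩ _ hflat h0 R hR hRR ν hν hlow hup φ hφ hφ0 hφ1 hφball hφsupp u u' hu hu'
    x hx
  have hxR : ‖x‖ < R := mem_ball_zero_iff.1 hx.2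
  obtain ⟨z, hz0, hzx, hzball⟩ := hflat.exists_chain hγ hΩ h0 hR hRR
    ⟨hν, fun y hy hlt => (hlow ⟨by simpa using hlt, hy⟩).1,
      fun y hy hyΩ => by simpa using (hup ⟨hyΩ, hy⟩).1⟩ hx.1 hxR
  have hφcont : Continuous φ := hφ.continuous
  have hφc : HasCompactSupport φ :=
    (isCompact_closedBall (0 : Ed d) _).of_isClosed_subset (isClosed_tsupport φ)
      (hφsupp.trans ball_subset_closedBall)
  have hφint : Integrable φ := hφcont.integrable_of_hasCompactSupport hφc
  have hI := pow_mul_volume_ball_le_integral (by positivity) hφint hφ0 hφball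
  rw [← hVdef] at hI
  set I := ∫ w, φ w with hIdef
  have hIpos : 0 < I := lt_of_lt_of_le (by positivity) hI
  have hw : ∀ w ∈ tsupport φ, ‖w‖ < R / (4 * 24 * 48) := fun w hw =>
    mem_ball_zero_iff.1 (hφsupp hw)
  have huc : ContinuousOn u Ω := fun y hy => (hu y hy).continuousAt.continuousWithinAt
  -- `s k` is the scale relative to `R`, `v k` the average at the `k`-th link of the chain
  obtain ⟨s, hs⟩ : ∃ s : ℕ → ℝ, s = fun k => 1 / 2 ^ k := ⟨_, rfl⟩
  have hspos : ∀ k, 0 < s k := fun k => by simp only [hs]; positivity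
  have hss : ∀ k, s (k + 1) = s k / 2 := fun k => by simp only [hs, pow_succ]; field_simp
  have hRs : ∀ k, R / 2 ^ k = R * s k := fun k => by simp only [hs]; ring
  simp only [hRs] at hzx hzball
  obtain ⟨v, hv⟩ : ∃ v : ℕ → ℝ, v = fun k => I⁻¹ * ∫ w, u (z k + s k • w) * φ w := ⟨_, rfl⟩
  have hv0 : v 0 = (∫ z, |φ z|)⁻¹ *
      ∫ z in ball ((R / 2) • ν) (R / (4 * 24 * 48)), u z * φ (z - (R / 2) • ν) := by
    simp only [abs_of_nonneg (hφ0 _)]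
    rw [setIntegral_eq_integral_of_forall_compl_eq_zero,
      ← integral_add_left_eq_self (fun y => u y * φ (y - (R / 2) • ν)) ((R / 2) • ν)]
    · simp [hv, hs, hz0, hIdef]
    · intro y hy
      rw [image_eq_zero_of_notMem_tsupport (f := φ), mul_zero]
      intro hmem
      exact hy (by rw [mem_ball, dist_eq_norm]; exact hw _ hmem)
  -- the straight paths between consecutive links
  have hpath : ∀ k, ∀ w ∈ tsupport φ, ∀ t ∈ Icc (0 : ℝ) 1,
      AffineMap.lineMap (z k) (z (k + 1)) t + (AffineMap.lineMap (s k) (s (k + 1)) t : ℝ) • w ∈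
        (Ω ∩ ball 0 (2 * R)) ∩ ball x (2 * (R * s k)) := by
    intro k w hwφ t ht
    have hseg : AffineMap.lineMap (z k) (z (k + 1)) t ∈ segment ℝ (z k) (z (k + 1)) := by
      rw [segment_eq_image_lineMap]; exact mem_image_of_mem _ ht
    set q := AffineMap.lineMap (z k) (z (k + 1)) t with hq
    set σ := (AffineMap.lineMap (s k) (s (k + 1)) t : ℝ) with hσ
    have hσv : σ = (1 - t) * s k + t * (s k / 2) := by
      rw [hσ, AffineMap.lineMap_apply_module, smul_eq_mul, smul_eq_mul, hss]
    have hsk := hspos k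
    have hσ0 : 0 ≤ σ := by rw [hσv]; nlinarith [ht.1, ht.2]
    have hσ1 : σ ≤ s k := by rw [hσv]; nlinarith [ht.1, ht.2]
    have hdist : dist (q + σ • w) q < R * s k / (4 * 24 * 48) := by
      rw [dist_eq_norm, add_sub_cancel_left, norm_smul, Real.norm_of_nonneg hσ0]
      calc σ * ‖w‖ ≤ s k * ‖w‖ := by gcongr
        _ < s k * (R / (4 * 24 * 48)) := by gcongr; exact hw w hwφ
        _ = _ := by ring
    refine ⟨hzball k q hseg hdist, ?_⟩
    have hqx : q ∈ closedBall x (3 / 2 * (R * s k)) := by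
      refine (convex_closedBall x _).segment_subset (hzx k) ((hzx (k + 1)).trans ?_) hseg
      rw [hss]
      nlinarith [mul_pos hR hsk]
    rw [mem_closedBall] at hqx
    have := dist_triangle (q + σ • w) q x
    rw [mem_ball]
    linarith [mul_pos hR hsk]
  have hint : ∀ k, Integrable fun w => u (z k + s k • w) * φ w := fun k =>
    (continuous_comp_add_smul_mul hΩ huc hφcont fun w hwφ => by
      simpa using (hpath k w hwφ 0 (by simp)).1.1).integrable_of_hasCompactSupport hφc.mul_left
  obtain ⟨G, hG⟩ : ∃ G : Ed d → ℝ≥0∞, G = (Ω ∩ ball 0 (2 * R)).indicator fun y => ‖u' y‖ₑ :=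
    ⟨_, rfl⟩
  have hmeasK : MeasurableSet (Ω ∩ ball (0 : Ed d) (2 * R)) :=
    hΩ.measurableSet.inter measurableSet_ball
  have hGm : Measurable G := by
    classical
    rw [hG, ← piecewise_eq_indicator]
    exact ContinuousOn.measurable_piecewise ((hu'.mono inter_subset_left).enorm)
      continuousOn_const hmeasK
  have hstep : ∀ k, ‖v k - v (k + 1)‖ₑ ≤ ENNReal.ofReal (C * ((R / 2 ^ k) ^ (d - 1))⁻¹) *
      ∫⁻ y, (ball x (2 * (R / 2 ^ k))).indicator G y := by
    intro k
    have hsk := hspos k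
    have h1 := enorm_integral_sub_integral_le (μ := (volume : Measure (Ed d))) (L := 3 * (R * s k))
      hΩ hu hu' hφcont hφc
      (fun w => by rw [Real.norm_of_nonneg (hφ0 w)]; exact hφ1 w)
      (hGm.indicator (measurableSet_ball (x := x) (ε := 2 * (R * s k)))) (hspos (k + 1))
      (by rw [hss]; linarith) (fun w hwφ t ht => (hpath k w hwφ t ht).1.1)
      (fun w hwφ t ht => by
        rw [indicator_of_mem (hpath k w hwφ t ht).2, hG,
          indicator_of_mem (hpath k w hwφ t ht).1])
      (fun w hwφ => by
        have h2 := (hpath k w hwφ 0 (by simp)).2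
        have h3 := (hpath (k + 1) w hwφ 0 (by simp)).2
        simp only [AffineMap.lineMap_apply_zero, mem_ball] at h2 h3
        have := dist_triangle_right (z k + s k • w) (z (k + 1) + s (k + 1) • w) x
        rw [hss] at h3 this ⊢
        linarith)
    rw [finrank_euclideanSpace_fin] at h1
    have h2 : v k - v (k + 1) = I⁻¹ * ((∫ w, u (z k + s k • w) * φ w) -
        ∫ w, u (z (k + 1) + s (k + 1) • w) * φ w) := by rw [hv]; ring
    rw [h2, enorm_mul, Real.enorm_of_nonneg (inv_nonneg.2 hIpos.le), hRs]
    refine (mul_le_mul_right h1 _).trans ?_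
    rw [← mul_assoc, ← ENNReal.ofReal_mul (by positivity)]
    refine mul_le_mul_left (ENNReal.ofReal_le_ofReal ?_) _
    obtain ⟨m, rfl⟩ := Nat.exists_eq_add_of_le' hd
    calc I⁻¹ * (3 * (R * s k) * (s (k + 1) ^ (m + 2))⁻¹)
        ≤ ((R / (2 * (4 * 24 * 48))) ^ (m + 2) * V)⁻¹ *
            (3 * (R * s k) * (s (k + 1) ^ (m + 2))⁻¹) := by
          have := hspos (k + 1)
          gcongr
      _ = C * ((R * s k) ^ (m + 2 - 1))⁻¹ := by
          rw [hss, hC, div_pow, div_pow, mul_pow, show m + 2 - 1 = m + 1 from rfl]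
          field_simp
          ring
  have htel : ∀ n, ‖u x - v 0‖ₑ ≤ ‖u x - v n‖ₑ + ∑ k ∈ Finset.range n, ‖v k - v (k + 1)‖ₑ := by
    intro n
    induction n with
    | zero => simp
    | succ n ih =>
      refine ih.trans ?_
      rw [Finset.sum_range_succ, add_comm (∑ k ∈ Finset.range n, _), ← add_assoc]
      gcongr
      have h := enorm_sub_le (a := u x - v (n + 1)) (b := v n - v (n + 1))
      rwa [sub_sub_sub_cancel_right] at h
  have hsum : ∀ n, ∑ k ∈ Finset.range n, ‖v k - v (k + 1)‖ₑ ≤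
      ENNReal.ofReal (C * 2 ^ d + 1) * ∫⁻ y in Ω ∩ ball (0 : Ed d) (2 * R),
        ENNReal.ofReal ‖u' y‖ * (edist x y) ^ ((1 : ℝ) - d) := by
    intro n
    calc _ ≤ ∑ k ∈ Finset.range n, ∫⁻ y, ENNReal.ofReal (C * ((R / 2 ^ k) ^ (d - 1))⁻¹) *
          (ball x (2 * (R / 2 ^ k))).indicator G y := Finset.sum_le_sum fun k _ => by
            rw [lintegral_const_mul' _ _ ENNReal.ofReal_ne_top]
            exact hstep k
      _ = ∫⁻ y, ∑ k ∈ Finset.range n, ENNReal.ofReal (C * ((R / 2 ^ k) ^ (d - 1))⁻¹) *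
          (ball x (2 * (R / 2 ^ k))).indicator G y := by
            rw [lintegral_finsetSum]
            exact fun k _ => (hGm.indicator measurableSet_ball).const_mul _
      _ ≤ ∫⁻ y, ENNReal.ofReal (C * 2 ^ d + 1) * (edist x y ^ ((1 : ℝ) - d) * G y) := by
            refine lintegral_mono fun y => ?_
            have h1 := sum_dyadic_kernel_le hd hCpos.le hR n x y
            rw [← mul_assoc]
            refine le_trans (le_of_eq ?_) (mul_le_mul_left h1 (G y))
            rw [Finset.sum_mul]
            refine Finset.sum_congr rfl fun k _ => ?_
            classical
            simp only [indicator_apply]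
            split_ifs <;> simp
      _ = _ := by
            rw [lintegral_const_mul' _ _ ENNReal.ofReal_ne_top, ← lintegral_indicator hmeasK, hG]
            congr 2 with y
            classical
            simp only [indicator_apply]
            split_ifs <;> simp [mul_comm]
  rw [← hv0, ← Real.norm_eq_abs, ofReal_norm]
  refine ENNReal.le_of_forall_pos_le_add fun ε hε _ => ?_
  obtain ⟨η, hη, hηu⟩ := Metric.continuousAt_iff.1 (hu x hx.1).continuousAt ε hε
  obtain ⟨n, hn⟩ := exists_pow_lt_of_lt_one (show 0 < η / (2 * R) by positivity)
    (show (1 / 2 : ℝ) < 1 by norm_num)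
  rw [add_comm]
  refine (htel n).trans <| add_le_add ?_ (hsum n)
  rw [← ofReal_norm, Real.norm_eq_abs]
  refine ENNReal.ofReal_le_of_le_toReal ?_
  rw [hv]
  refine abs_sub_inv_integral_mul_le (hint n) hφint hφ0 hIpos fun w hwφ => ?_
  have h2 := (hpath n w hwφ 0 (by simp)).2
  simp only [AffineMap.lineMap_apply_zero, mem_ball] at h2
  have h3 : 2 * (R * s n) < η := by
    rw [lt_div_iff₀ (by positivity), one_div_pow] at hn
    simp only [hs]
    linarith
  rw [← Real.dist_eq, dist_comm]
  exact (hηu (h2.trans h3)).le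
end
end
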